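/- arXiv:2412.13373 — 2 statements merged into one kernel-verified Lean document; each statement's English description precedes it below -/
import Mathlib

section
/- Let L̂ = MD. Then the permutation relation R L̂₁ R M₁ = M₁ R L̂₁ R⁻¹ + R M₁ holds in Mat_{N²}(A), where L̂₁ = L̂ ⊗ I and M₁ = M ⊗ I. -/
open scoped BigOperators

noncomputable section

/-- One-site embedding of an `N×N` matrix into `Mat_{N^k}` at 0-based position `i`
(the paper's `X_{i+1}` in 1-based numbering).  Out of range we return the identity. -/
def matAt {α : Type*} [Semiring α] (N k : ℕ) (X : Matrix (Fin N) (Fin N) α) (i : ℕ) :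
    Matrix (Fin k → Fin N) (Fin k → Fin N) α :=
  if h : i < k then
    Matrix.of fun a b =>
      if ∀ l : Fin k, (l : ℕ) ≠ i → a l = b l then X (a ⟨i, h⟩) (b ⟨i, h⟩) else 0
  else 1

/-- Two-site embedding of an operator on `V⊗V` into `Mat_{N^k}` at 0-based positions
`i, i+1` (the paper's `R_{i+1}` in 1-based numbering). -/
def opAt {α : Type*} [Semiring α] (N k : ℕ)
    (R : Matrix (Fin N × Fin N) (Fin N × Fin N) α) (i : ℕ) :
    Matrix (Fin k → Fin N) (Fin k → Fin N) α :=
  if h : i + 1 < k then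
    Matrix.of fun a b =>
      if ∀ l : Fin k, (l : ℕ) ≠ i → (l : ℕ) ≠ i + 1 → a l = b l then
        R (a ⟨i, by omega⟩, a ⟨i + 1, h⟩) (b ⟨i, by omega⟩, b ⟨i + 1, h⟩)
      else 0
  else 1

/-- A numeric (complex) matrix viewed inside `Mat(A)` via the unit of `A`. -/
def toA (A : Type*) [Semiring A] [Algebra ℂ A] {ι : Type*} (X : Matrix ι ι ℂ) :
    Matrix ι ι A :=
  X.map (algebraMap ℂ A)

/-- The braid relation `R₁R₂R₁ = R₂R₁R₂` on `V^{⊗3}`. -/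
def IsBraid (N : ℕ) (R : Matrix (Fin N × Fin N) (Fin N × Fin N) ℂ) : Prop :=
  opAt N 3 R 0 * opAt N 3 R 1 * opAt N 3 R 0 = opAt N 3 R 1 * opAt N 3 R 0 * opAt N 3 R 1

/-- The Hecke condition `(q·I − R)(q⁻¹·I + R) = 0`. -/
def IsHecke (N : ℕ) (q : ℂ) (R : Matrix (Fin N × Fin N) (Fin N × Fin N) ℂ) : Prop :=
  (q • (1 : Matrix (Fin N × Fin N) (Fin N × Fin N) ℂ) - R) * (q⁻¹ • 1 + R) = 0

/-- `q` is generic: `q ∉ {0, 1, −1}` and `qⁿ ≠ 1` for all positive integers `n`. -/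
def GenericQ (q : ℂ) : Prop :=
  q ≠ 0 ∧ q ≠ 1 ∧ q ≠ -1 ∧ ∀ n : ℕ, 0 < n → q ^ n ≠ 1

/-- The reflection-equation type relation `R X₁ R X₁ = X₁ R X₁ R` in `Mat_{N²}`. -/
def RErel {α : Type*} [Semiring α] (N : ℕ)
    (R : Matrix (Fin N × Fin N) (Fin N × Fin N) α) (X : Matrix (Fin N) (Fin N) α) : Prop :=
  opAt N 2 R 0 * matAt N 2 X 0 * opAt N 2 R 0 * matAt N 2 X 0 =
    matAt N 2 X 0 * opAt N 2 R 0 * matAt N 2 X 0 * opAt N 2 R 0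

/-- The quantum-double permutation relation `D₁ R M₁ R = R M₁ R⁻¹ D₁ + R` in `Mat_{N²}(A)`. -/
def PermRel {A : Type*} [Ring A] [Algebra ℂ A] (N : ℕ)
    (R Rinv : Matrix (Fin N × Fin N) (Fin N × Fin N) ℂ)
    (M D : Matrix (Fin N) (Fin N) A) : Prop :=
  matAt N 2 D 0 * opAt N 2 (toA A R) 0 * matAt N 2 M 0 * opAt N 2 (toA A R) 0 =
    opAt N 2 (toA A R) 0 * matAt N 2 M 0 * opAt N 2 (toA A Rinv) 0 * matAt N 2 D 0 +
      opAt N 2 (toA A R) 0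

/-- The homogeneous permutation relation `D₁ R M₁ R = R M₁ R⁻¹ D₁` in `Mat_{N²}(A)`. -/
def PermRelHom {A : Type*} [Ring A] [Algebra ℂ A] (N : ℕ)
    (R Rinv : Matrix (Fin N × Fin N) (Fin N × Fin N) ℂ)
    (M D : Matrix (Fin N) (Fin N) A) : Prop :=
  matAt N 2 D 0 * opAt N 2 (toA A R) 0 * matAt N 2 M 0 * opAt N 2 (toA A R) 0 =
    opAt N 2 (toA A R) 0 * matAt N 2 M 0 * opAt N 2 (toA A Rinv) 0 * matAt N 2 D 0

/-- Overline copies: `ovCopy … r = X_{⟨r+1⟩}`, i.e. `X_{⟨1⟩} = X⊗I⊗⋯⊗I` and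
`X_{⟨r+1⟩} = R_r X_{⟨r⟩} R_r⁻¹`. -/
def ovCopy {α : Type*} [Semiring α] (N k : ℕ)
    (R Rinv : Matrix (Fin N × Fin N) (Fin N × Fin N) α)
    (X : Matrix (Fin N) (Fin N) α) : ℕ → Matrix (Fin k → Fin N) (Fin k → Fin N) α
  | 0 => matAt N k X 0
  | r + 1 => opAt N k R r * ovCopy N k R Rinv X r * opAt N k Rinv r

/-- Underline copies: `unCopy … r = X_{[r+1]}`, i.e. `X_{[1]} = X⊗I⊗⋯⊗I` and
`X_{[r+1]} = R_r⁻¹ X_{[r]} R_r`. -/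
def unCopy {α : Type*} [Semiring α] (N k : ℕ)
    (R Rinv : Matrix (Fin N × Fin N) (Fin N × Fin N) α)
    (X : Matrix (Fin N) (Fin N) α) : ℕ → Matrix (Fin k → Fin N) (Fin k → Fin N) α
  | 0 => matAt N k X 0
  | r + 1 => opAt N k Rinv r * unCopy N k R Rinv X r * opAt N k R r

/-- `X_{⟨1→n⟩} = X_{⟨1⟩}X_{⟨2⟩}⋯X_{⟨n⟩}`. -/
def ovProd {α : Type*} [Semiring α] (N k : ℕ)
    (R Rinv : Matrix (Fin N × Fin N) (Fin N × Fin N) α)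
    (X : Matrix (Fin N) (Fin N) α) (n : ℕ) : Matrix (Fin k → Fin N) (Fin k → Fin N) α :=
  ((List.range n).map (ovCopy N k R Rinv X)).prod

/-- `X_{⟨n→1⟩} = X_{⟨n⟩}X_{⟨n−1⟩}⋯X_{⟨1⟩}`. -/
def ovProdRev {α : Type*} [Semiring α] (N k : ℕ)
    (R Rinv : Matrix (Fin N × Fin N) (Fin N × Fin N) α)
    (X : Matrix (Fin N) (Fin N) α) (n : ℕ) : Matrix (Fin k → Fin N) (Fin k → Fin N) α :=
  ((List.range n).reverse.map (ovCopy N k R Rinv X)).prod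

/-- Shifted Jucys–Murphy matrices: `JMup … R n s = J_{s+1}^{↑n}`, i.e. `J₁^{↑n} = I` and
`J_{s+1}^{↑n} = R_{n+s} J_s^{↑n} R_{n+s}` (paper's 1-based `R_{n+s}` is `opAt … (n+s-1)`).
Applying it to `R⁻¹` produces `(J_{s+1}^{↑n})⁻¹`. -/
def JMup {α : Type*} [Semiring α] (N k : ℕ)
    (R : Matrix (Fin N × Fin N) (Fin N × Fin N) α) (n : ℕ) :
    ℕ → Matrix (Fin k → Fin N) (Fin k → Fin N) α
  | 0 => 1
  | s + 1 => opAt N k R (n + s) * JMup N k R n s * opAt N k R (n + s)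

/-- The quantum trace `Tr_{R(1…n)}(X) = Tr(C₁C₂⋯C_n X)`. -/
def qTr {α : Type*} [Semiring α] (N n : ℕ) (C : Matrix (Fin N) (Fin N) α)
    (X : Matrix (Fin n → Fin N) (Fin n → Fin N) α) : α :=
  Matrix.trace (((List.range n).map (matAt N n C)).prod * X)

/-- The matrix `C`, `C_i^j = Σ_k Ψ_{ik}^{jk}`. -/
def traceMat (N : ℕ) (Ψ : Matrix (Fin N × Fin N) (Fin N × Fin N) ℂ) :
    Matrix (Fin N) (Fin N) ℂ :=
  Matrix.of fun i j => ∑ k, Ψ (i, k) (j, k)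

/-- Skew-invertibility of `R`: `Tr₂(R₁₂Ψ₂₃) = Tr₂(Ψ₁₂R₂₃) = P₁₃`, written componentwise. -/
def SkewInv (N : ℕ) (R Ψ : Matrix (Fin N × Fin N) (Fin N × Fin N) ℂ) : Prop :=
  (∀ i k l n : Fin N, ∑ j, ∑ b, R (i, j) (l, b) * Ψ (b, k) (j, n) =
      if i = n ∧ k = l then 1 else 0) ∧
  (∀ i k l n : Fin N, ∑ j, ∑ b, Ψ (i, j) (l, b) * R (b, k) (j, n) =
      if i = n ∧ k = l then 1 else 0)

/-- The generators `R₁, …, R_{n−1}` (1-based) of the Hecke-algebra image inside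
`End(V^{⊗k})`, as a subset of `Mat_{N^k}`. -/
def genSet {α : Type*} [Semiring α] (N k n : ℕ)
    (R : Matrix (Fin N × Fin N) (Fin N × Fin N) α) :
    Set (Matrix (Fin k → Fin N) (Fin k → Fin N) α) :=
  {X | ∃ i : ℕ, i + 1 < n ∧ X = opAt N k R i}

/-- The left ideal of `A` generated by the entries of `D`. -/
def entryIdeal (A : Type*) [Ring A] {N : ℕ} (D : Matrix (Fin N) (Fin N) A) :
    Submodule A A :=
  Submodule.span A {x : A | ∃ i j : Fin N, x = D i j}

/-- The normally ordered monomial `:L̂_{⟨1→k⟩}: = M_{⟨1→k⟩} D_{⟨k→1⟩} ∏_{s=1}^{k} J_s⁻¹`. -/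
def normOrd {α : Type*} [Semiring α] (N k : ℕ)
    (R Rinv : Matrix (Fin N × Fin N) (Fin N × Fin N) α)
    (M D : Matrix (Fin N) (Fin N) α) (n : ℕ) :
    Matrix (Fin k → Fin N) (Fin k → Fin N) α :=
  ovProd N k R Rinv M n * ovProdRev N k R Rinv D n *
    ((List.range n).map (fun s => JMup N k Rinv 0 s)).prod

/-- In two-site space, `opAt` at position `0` is a reindexing. -/
theorem opAt_two_zero {α : Type*} [Semiring α] (N : ℕ)
    (X : Matrix (Fin N × Fin N) (Fin N × Fin N) α) :
    opAt N 2 X 0 =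
      X.submatrix (finTwoArrowEquiv (Fin N)) (finTwoArrowEquiv (Fin N)) := by
  ext a b
  simp [opAt, finTwoArrowEquiv, Fin.forall_fin_two]

/-- In two-site space, `matAt` at position `0` is a reindexed block-diagonal matrix. -/
theorem matAt_two_zero {α : Type*} [Semiring α] (N : ℕ) (X : Matrix (Fin N) (Fin N) α) :
    matAt N 2 X 0 =
      (Matrix.blockDiagonal fun _ : Fin N => X).submatrix
        (finTwoArrowEquiv (Fin N)) (finTwoArrowEquiv (Fin N)) := by
  ext a b
  simp [matAt, finTwoArrowEquiv, Fin.forall_fin_two, Matrix.blockDiagonal_apply]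

theorem matAt_two_zero_mul {α : Type*} [Semiring α] (N : ℕ) (X Y : Matrix (Fin N) (Fin N) α) :
    matAt N 2 (X * Y) 0 = matAt N 2 X 0 * matAt N 2 Y 0 := by
  simp only [matAt_two_zero, Matrix.submatrix_mul_equiv, ← Matrix.blockDiagonal_mul]

theorem opAt_two_zero_toA_mul_eq_one {A : Type*} [Ring A] [Algebra ℂ A] {N : ℕ}
    {X Y : Matrix (Fin N × Fin N) (Fin N × Fin N) ℂ} (h : X * Y = 1) :
    opAt N 2 (toA A X) 0 * opAt N 2 (toA A Y) 0 = 1 := by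
  rw [opAt_two_zero, opAt_two_zero, Matrix.submatrix_mul_equiv, toA, toA, ← Matrix.map_mul, h,
    Matrix.map_one _ (map_zero _) (map_one _), Matrix.submatrix_one_equiv]

/-- The permutation relation for `m * d`, in an arbitrary ring. -/
theorem permutation_relation_mul {S : Type*} [Ring S] {r s m d : S} (hrs : r * s = 1)
    (hm : r * m * r * m = m * r * m * r) (hdm : d * r * m * r = r * m * s * d + r) :
    r * (m * d) * r * m = m * r * (m * d) * s + r * m := by
  calc r * (m * d) * r * m = r * m * (d * r * m * r) * s := by
        simp only [mul_assoc, hrs, mul_one]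
    _ = (r * m * r * m) * s * d * s + r * m * (r * s) := by
        rw [hdm]; noncomm_ring
    _ = m * r * m * (r * s) * d * s + r * m * (r * s) := by
        rw [hm]; simp only [mul_assoc]
    _ = m * r * (m * d) * s + r * m := by
        simp only [hrs, mul_one, mul_assoc]

/-- `L̂ = MD` satisfies the permutation relation
`R L̂₁ R M₁ = M₁ R L̂₁ R⁻¹ + R M₁` in `Mat_{N²}(A)`. -/
theorem stmt1 {A : Type*} [Ring A] [Algebra ℂ A] (N : ℕ) (hN : 1 ≤ N) (q : ℂ)
    (hq : GenericQ q)
    (R Rinv : Matrix (Fin N × Fin N) (Fin N × Fin N) ℂ)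
    (hRinv : R * Rinv = 1 ∧ Rinv * R = 1)
    (hbraid : IsBraid N R) (hHecke : IsHecke N q R)
    (M D : Matrix (Fin N) (Fin N) A)
    (hM : RErel N (toA A R) M)
    (hD : RErel N (toA A Rinv) D)
    (hDM : PermRel N R Rinv M D) :
    opAt N 2 (toA A R) 0 * matAt N 2 (M * D) 0 * opAt N 2 (toA A R) 0 * matAt N 2 M 0 =
      matAt N 2 M 0 * opAt N 2 (toA A R) 0 * matAt N 2 (M * D) 0 *
          opAt N 2 (toA A Rinv) 0 +
        opAt N 2 (toA A R) 0 * matAt N 2 M 0 := by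
  rw [matAt_two_zero_mul]
  exact permutation_relation_mul (opAt_two_zero_toA_mul_eq_one hRinv.1) hM hDM
end
end

section
/- For every k ≥ 1 the following identity holds in Mat_{N^{k+1}}(A): D₁ M_{⟨2⟩} M_{⟨3⟩} ⋯ M_{⟨k+1⟩} = M_{⟨2⟩} ⋯ M_{⟨k+1⟩} D₁ R⁻¹_{1→k} R⁻¹_{k→1} + Σ_{s=2}^{k+1} M_{⟨2⟩} ⋯ M̂_{⟨s⟩} ⋯ M_{⟨k+1⟩} · R⁻¹_{1→(s−1)} R⁻¹_{(s−2)→1}, where in the s-th summand the factor M_{⟨s⟩} is omitted and the R-chain is the palindromic product R₁⁻¹R₂⁻¹⋯R_{s−1}⁻¹R_{s−2}⁻¹⋯R₁⁻¹ (equal to R₁⁻¹ when s = 2). -/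
open scoped BigOperators

noncomputable section

section ExchangeRelation

variable {B : Type*} [Ring B] {u : ℕ → Bˣ} {m : ℕ → B} {d : B} {K : ℕ}

theorem commute_copy_of_lt (hm : ∀ i, m (i + 1) = u i * m i * ↑(u i)⁻¹)
    (hfar : ∀ i j, i + 2 ≤ j → Commute (u i : B) (u j))
    (hm0 : ∀ j, 1 ≤ j → Commute (m 0) (u j : B)) {n j : ℕ} (h : n < j) :
    Commute (m n) (u j : B) := by
  induction n with
  | zero => exact hm0 j h
  | succ n ih =>
    rw [hm]
    have hf := hfar n j h
    exact (hf.mul_left (ih (by omega))).mul_left hf.units_inv_left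

theorem braid_inv {x y : Bˣ} (h : x * y * x = y * x * y) :
    (↑x⁻¹ * ↑y⁻¹ * ↑x⁻¹ : B) = ↑y⁻¹ * ↑x⁻¹ * ↑y⁻¹ := by
  have h' := congrArg (fun z : Bˣ => ((z⁻¹ : Bˣ) : B)) h
  simpa [mul_assoc] using h'

theorem inv_mul_braid {x y : Bˣ} (h : x * y * x = y * x * y) :
    (↑x⁻¹ * ↑y * ↑x : B) = ↑y * ↑x * ↑y⁻¹ := by
  have h' : x⁻¹ * y * x = y * x * y⁻¹ := by
    rw [eq_mul_inv_iff_mul_eq, mul_assoc, mul_assoc, inv_mul_eq_iff_eq_mul, ← mul_assoc,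
      ← mul_assoc, ← h]
  exact_mod_cast congrArg (fun z : Bˣ => (z : B)) h'

theorem commute_copy_of_add_two_le (hm : ∀ i, m (i + 1) = u i * m i * ↑(u i)⁻¹)
    (hfar : ∀ i j, i + 2 ≤ j → Commute (u i : B) (u j))
    (hm0 : ∀ j, 1 ≤ j → Commute (m 0) (u j : B))
    (hbr : ∀ i, i + 1 < K → u i * u (i + 1) * u i = u (i + 1) * u i * u (i + 1))
    {n j : ℕ} (hn : n ≤ K) (h : j + 2 ≤ n) : Commute (m n) (↑(u j)⁻¹ : B) := by
  induction n with
  | zero => omega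
  | succ n ih =>
    rcases (show j + 2 ≤ n ∨ n = j + 1 by omega) with h' | rfl
    · have hf : Commute (u n : B) (↑(u j)⁻¹ : B) := (hfar j n h').symm.units_inv_right
      rw [hm]
      exact (hf.mul_left (ih (by omega) h')).mul_left hf.units_inv_left
    · have hb := hbr j (by omega)
      have h1 := inv_mul_braid hb
      have h2 := braid_inv hb
      have h3 : Commute (m j) (↑(u (j + 1))⁻¹ : B) :=
        (commute_copy_of_lt hm hfar hm0 (Nat.lt_succ_self j)).units_inv_right
      rw [hm, hm]
      set x := (u j : B)
      set x' := (↑(u j)⁻¹ : B)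
      set y := (u (j + 1) : B)
      set y' := (↑(u (j + 1))⁻¹ : B)
      calc y * (x * m j * x') * y' * x' = y * x * m j * (x' * y' * x') := by noncomm_ring
        _ = y * x * (m j * y') * x' * y' := by rw [h2]; noncomm_ring
        _ = (y * x * y') * m j * x' * y' := by rw [h3.eq]; noncomm_ring
        _ = x' * (y * (x * m j * x') * y') := by rw [← h1]; noncomm_ring

theorem commute_prod_map {ι : Type*} {x : B} {f : ι → B} {l : List ι}
    (h : ∀ i ∈ l, Commute x (f i)) : Commute x (l.map f).prod :=
  Commute.list_prod_right _ _ (by simpa using h)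

theorem mul_copy_mul_chain (hm : ∀ i, m (i + 1) = u i * m i * ↑(u i)⁻¹)
    (hfar : ∀ i j, i + 2 ≤ j → Commute (u i : B) (u j))
    (hd : ∀ j, 1 ≤ j → Commute d (u j : B))
    (hbr : ∀ i, i + 1 < K → u i * u (i + 1) * u i = u (i + 1) * u i * u (i + 1))
    (hdm : d * m 1 = m 1 * d * ↑(u 0)⁻¹ * ↑(u 0)⁻¹ + ↑(u 0)⁻¹)
    {n : ℕ} (hn : n < K) :
    d * m (n + 1) * ((List.range n).map fun i => (↑(u i)⁻¹ : B)).prod =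
      m (n + 1) * d * ((List.range (n + 1)).map fun i => (↑(u i)⁻¹ : B)).prod * ↑(u n)⁻¹ +
        ((List.range (n + 1)).map fun i => (↑(u i)⁻¹ : B)).prod := by
  induction n with
  | zero => simpa using hdm
  | succ n ih =>
    have ih := ih (by omega)
    have h2 := braid_inv (hbr n hn)
    have hdn : Commute d (u (n + 1) : B) := hd _ (by omega)
    have hc : Commute (↑(u (n + 1))⁻¹ : B)
        ((List.range n).map fun i => (↑(u i)⁻¹ : B)).prod := by
      refine commute_prod_map fun i hi => ?_
      rw [List.mem_range] at hi
      exact (hfar i (n + 1) (by omega)).symm.units_inv_left.units_inv_right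
    rw [hm (n + 1)]
    simp only [List.range_succ (n := n + 1), List.range_succ (n := n), List.map_append,
      List.prod_append, List.map_cons, List.map_nil, List.prod_singleton] at ih ⊢
    set C := ((List.range n).map fun i => (↑(u i)⁻¹ : B)).prod
    have hyy : (u (n + 1) : B) * ↑(u (n + 1))⁻¹ = 1 := Units.mul_inv _
    have hyy' : (↑(u (n + 1))⁻¹ : B) * u (n + 1) = 1 := Units.inv_mul _
    set y := (u (n + 1) : B)
    set y' := (↑(u (n + 1))⁻¹ : B)
    set x' := (↑(u n)⁻¹ : B)
    set M := m (n + 1)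
    have key : y * C * x' * y' * x' = C * x' * y' :=
      calc y * C * x' * y' * x' = y * C * (x' * y' * x') := by noncomm_ring
        _ = y * (C * y') * x' * y' := by rw [h2]; noncomm_ring
        _ = (y * y') * C * x' * y' := by rw [← hc.eq]; noncomm_ring
        _ = C * x' * y' := by rw [hyy, one_mul]
    calc d * (y * M * y') * (C * x') = (d * y) * M * (y' * C) * x' := by noncomm_ring
      _ = y * (d * M * C) * y' * x' := by rw [hdn.eq, hc.eq]; noncomm_ring
      _ = y * M * d * C * (x' * (x' * y' * x')) + y * C * x' * y' * x' := by
        rw [ih]; noncomm_ring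
      _ = y * M * d * C * (x' * y' * x' * y') + C * x' * y' := by
        rw [key, h2]
        congr 2
        rw [← mul_assoc, ← mul_assoc, h2]
      _ = y * M * 1 * d * (C * x' * y' * x' * y') + C * x' * y' := by noncomm_ring
      _ = y * M * y' * (y * d) * (C * x' * y' * x' * y') + C * x' * y' := by
        rw [← hyy']; noncomm_ring
      _ = y * M * y' * d * (y * C * x' * y' * x') * y' + C * x' * y' := by
        rw [← hdn.eq]; noncomm_ring
      _ = y * M * y' * d * (C * x' * y') * y' + C * x' * y' := by rw [key]

theorem mul_copies_eq (hm : ∀ i, m (i + 1) = u i * m i * ↑(u i)⁻¹)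
    (hfar : ∀ i j, i + 2 ≤ j → Commute (u i : B) (u j))
    (hm0 : ∀ j, 1 ≤ j → Commute (m 0) (u j : B))
    (hd : ∀ j, 1 ≤ j → Commute d (u j : B))
    (hbr : ∀ i, i + 1 < K → u i * u (i + 1) * u i = u (i + 1) * u i * u (i + 1))
    (hdm : d * m 1 = m 1 * d * ↑(u 0)⁻¹ * ↑(u 0)⁻¹ + ↑(u 0)⁻¹)
    {n : ℕ} (hn : n ≤ K) :
    d * ((List.range' 1 n).map m).prod =
      ((List.range' 1 n).map m).prod * d *
          ((List.range n).map fun i => (↑(u i)⁻¹ : B)).prod *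
          ((List.range n).reverse.map fun i => (↑(u i)⁻¹ : B)).prod +
        ∑ s ∈ Finset.Icc 2 (n + 1),
          (((List.range' 1 n).filter (fun r => r != s - 1)).map m).prod *
            ((List.range (s - 1)).map fun i => (↑(u i)⁻¹ : B)).prod *
            ((List.range (s - 2)).reverse.map fun i => (↑(u i)⁻¹ : B)).prod := by
  induction n with
  | zero => simp
  | succ n ih =>
    have ih := ih (by omega)
    have hcomm : ∀ l : List ℕ, (∀ i ∈ l, i < n) →
        Commute (m (n + 1)) (l.map fun i => (↑(u i)⁻¹ : B)).prod := fun l hl =>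
      commute_prod_map fun i hi =>
        commute_copy_of_add_two_le hm hfar hm0 hbr hn (by have := hl i hi; omega)
    have hrange : List.range' 1 (n + 1) = List.range' 1 n ++ [n + 1] := by
      rw [List.range'_concat, one_mul, add_comm 1 n]
    have hlast : (List.range' 1 (n + 1)).filter (fun r => r != n + 1 + 1 - 1) =
        List.range' 1 n := by
      rw [hrange, List.filter_append, List.filter_eq_self.2]
      · simp
      · intro a ha
        rw [List.mem_range'_1] at ha
        simp only [bne_iff_ne]
        omega
    have hsum : ∑ s ∈ Finset.Icc 2 (n + 1),
          (((List.range' 1 (n + 1)).filter (fun r => r != s - 1)).map m).prod *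
            ((List.range (s - 1)).map fun i => (↑(u i)⁻¹ : B)).prod *
            ((List.range (s - 2)).reverse.map fun i => (↑(u i)⁻¹ : B)).prod =
        (∑ s ∈ Finset.Icc 2 (n + 1),
          (((List.range' 1 n).filter (fun r => r != s - 1)).map m).prod *
            ((List.range (s - 1)).map fun i => (↑(u i)⁻¹ : B)).prod *
            ((List.range (s - 2)).reverse.map fun i => (↑(u i)⁻¹ : B)).prod) * m (n + 1) := by
      rw [Finset.sum_mul]
      refine Finset.sum_congr rfl fun s hs => ?_
      rw [Finset.mem_Icc] at hs
      have hf : [n + 1].filter (fun r => r != s - 1) = [n + 1] := by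
        rw [List.filter_eq_self]
        intro a ha
        rw [List.mem_singleton] at ha
        simp only [bne_iff_ne]
        omega
      have h1 := hcomm (List.range (s - 1)) fun i hi => by
        rw [List.mem_range] at hi; omega
      have h2 := hcomm (List.range (s - 2)).reverse fun i hi => by
        rw [List.mem_reverse, List.mem_range] at hi; omega
      rw [hrange, List.filter_append, hf, List.map_append, List.prod_append, List.map_singleton,
        List.prod_singleton, mul_assoc, mul_assoc, (h1.mul_right h2).eq]
      noncomm_ring
    have h1 := hcomm (List.range n) fun i hi => List.mem_range.1 hi
    have h2 := hcomm (List.range n).reverse fun i hi => by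
      rwa [List.mem_reverse, List.mem_range] at hi
    have hchain := mul_copy_mul_chain hm hfar hd hbr hdm (n := n) (by omega)
    have hrev : ((List.range (n + 1)).reverse.map fun i => (↑(u i)⁻¹ : B)).prod =
        ↑(u n)⁻¹ * ((List.range n).reverse.map fun i => (↑(u i)⁻¹ : B)).prod := by
      simp [List.range_succ]
    rw [Finset.sum_Icc_succ_top (by omega), hsum, hlast, hrev, hrange, List.map_append,
      List.prod_append, List.map_singleton, List.prod_singleton, ← mul_assoc, ih, add_mul]
    simp only [Nat.add_sub_cancel, show n + 1 + 1 - 2 = n from rfl]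
    set P := ((List.range' 1 n).map m).prod
    set C := ((List.range n).map fun i => (↑(u i)⁻¹ : B)).prod
    set C' := ((List.range n).reverse.map fun i => (↑(u i)⁻¹ : B)).prod
    have hmain : P * d * C * C' * m (n + 1) = P * (d * m (n + 1) * C) * C' := by
      rw [mul_assoc _ C' _, ← h2.eq, ← mul_assoc, mul_assoc _ C _, ← h1.eq]
      noncomm_ring
    rw [hmain, hchain]
    noncomm_ring

end ExchangeRelation

section LocalEmbedding

variable {α σ ι κ κ' : Type*} [Semiring α]

open Classical in
/-- The operator on `V^{⊗ι}` acting as `X` on the tensor factors in the image of `e` and as the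
identity on all others. -/
def localEmbed (e : κ ↪ ι) (X : Matrix (κ → σ) (κ → σ) α) :
    Matrix (ι → σ) (ι → σ) α :=
  Matrix.of fun a b => if ∀ l, l ∉ Set.range e → a l = b l then X (a ∘ e) (b ∘ e) else 0

theorem exists_localEmbed_eq (e : κ ↪ ι) [DecidableEq ({l // l ∉ Set.range e} → σ)] :
    ∃ φ : (ι → σ) ≃ (κ → σ) × ({l // l ∉ Set.range e} → σ),
      ∀ X : Matrix (κ → σ) (κ → σ) α,
        localEmbed e X = (Matrix.blockDiagonal fun _ => X).submatrix φ φ := by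
  classical
  refine ⟨(Equiv.piEquivPiSubtypeProd (· ∈ Set.range e) fun _ => σ).trans
    (Equiv.prodCongr ((Equiv.ofInjective e e.injective).symm.arrowCongr (Equiv.refl σ))
      (Equiv.refl _)), fun X => ?_⟩
  ext a b
  simp only [localEmbed, Matrix.of_apply, Matrix.submatrix_apply, Matrix.blockDiagonal_apply]
  congr 1
  simp [funext_iff]

theorem localEmbed_add (e : κ ↪ ι) (X Y : Matrix (κ → σ) (κ → σ) α) :
    localEmbed e (X + Y) = localEmbed e X + localEmbed e Y := by
  ext a b
  simp only [localEmbed, Matrix.of_apply, Matrix.add_apply]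
  split_ifs <;> simp

theorem localEmbed_mul [Fintype σ] [Fintype ι] [DecidableEq ι] [Fintype κ] [DecidableEq κ]
    (e : κ ↪ ι) (X Y : Matrix (κ → σ) (κ → σ) α) :
    localEmbed e (X * Y) = localEmbed e X * localEmbed e Y := by
  classical
  obtain ⟨φ, hφ⟩ := exists_localEmbed_eq (α := α) (σ := σ) e
  rw [hφ, hφ, hφ, Matrix.submatrix_mul_equiv, Matrix.blockDiagonal_mul]

theorem localEmbed_one [DecidableEq σ] [Fintype ι] [Fintype κ] (e : κ ↪ ι) :
    localEmbed e (1 : Matrix (κ → σ) (κ → σ) α) = 1 := by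
  classical
  obtain ⟨φ, hφ⟩ := exists_localEmbed_eq (α := α) (σ := σ) e
  rw [hφ]
  have : (Matrix.blockDiagonal fun _ : {l // l ∉ Set.range e} → σ =>
      (1 : Matrix (κ → σ) (κ → σ) α)) = 1 := Matrix.blockDiagonal_one
  rw [this, Matrix.submatrix_one_equiv]

open Classical in
theorem localEmbed_mul_apply [Fintype σ] [Fintype ι] [DecidableEq ι] {e : κ ↪ ι} {f : κ' ↪ ι}
    (h : Disjoint (Set.range e) (Set.range f)) (X : Matrix (κ → σ) (κ → σ) α)
    (Y : Matrix (κ' → σ) (κ' → σ) α) (a b : ι → σ) :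
    (localEmbed e X * localEmbed f Y) a b =
      if ∀ l, l ∉ Set.range e → l ∉ Set.range f → a l = b l then
        X (a ∘ e) (b ∘ e) * Y (a ∘ f) (b ∘ f) else 0 := by
  have hf : ∀ t, f t ∉ Set.range e := fun t ht =>
    Set.disjoint_left.1 h ht (Set.mem_range_self t)
  have he : ∀ t, e t ∉ Set.range f := fun t ht =>
    Set.disjoint_left.1 h (Set.mem_range_self t) ht
  rw [Matrix.mul_apply, Finset.sum_eq_single fun l => if l ∈ Set.range e then b l else a l]
  · have h1 : (fun l => if l ∈ Set.range e then b l else a l) ∘ e = b ∘ e := by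
      ext t; simp
    have h2 : (fun l => if l ∈ Set.range e then b l else a l) ∘ f = a ∘ f := by
      ext t; simp only [Function.comp_apply, if_neg (hf t)]
    simp only [localEmbed, Matrix.of_apply, h1, h2]
    rw [if_pos fun l hl => by rw [if_neg hl]]
    have : (∀ l, l ∉ Set.range f → (if l ∈ Set.range e then b l else a l) = b l) ↔
        ∀ l, l ∉ Set.range e → l ∉ Set.range f → a l = b l := by
      refine forall_congr' fun l => ?_
      by_cases hl : l ∈ Set.range e <;> simp [hl]
    simp only [this, mul_ite, mul_zero]
  · intro c _ hc
    by_contra hne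
    apply hc
    simp only [localEmbed, Matrix.of_apply] at hne
    have h1 : ∀ l, l ∉ Set.range e → a l = c l := by
      by_contra h'
      rw [if_neg h', zero_mul] at hne
      exact hne rfl
    have h2 : ∀ l, l ∉ Set.range f → c l = b l := by
      by_contra h'
      rw [if_neg h', mul_zero] at hne
      exact hne rfl
    ext l
    split_ifs with hl
    · exact h2 l (Set.disjoint_left.1 h hl)
    · exact (h1 l hl).symm
  · simp

theorem localEmbed_commute [Fintype σ] [Fintype ι] [DecidableEq ι] {e : κ ↪ ι} {f : κ' ↪ ι}
    (h : Disjoint (Set.range e) (Set.range f)) {X : Matrix (κ → σ) (κ → σ) α}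
    {Y : Matrix (κ' → σ) (κ' → σ) α} (hXY : ∀ i j i' j', Commute (X i j) (Y i' j')) :
    Commute (localEmbed e X) (localEmbed f Y) := by
  ext a b
  rw [localEmbed_mul_apply h, localEmbed_mul_apply h.symm, (hXY _ _ _ _).eq]
  congr 1
  exact propext (forall_congr' fun l => ⟨fun h h1 h2 => h h2 h1, fun h h1 h2 => h h2 h1⟩)

end LocalEmbedding

section TensorFactors

variable {α : Type*} [Semiring α] {N k m : ℕ}

/-- The inclusion of the `m` consecutive tensor positions starting at `i`. -/
def window (i : ℕ) (h : i + m ≤ k) : Fin m ↪ Fin k :=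
  ⟨fun t => ⟨i + t, by omega⟩, fun s t hst => Fin.ext (by simpa using hst)⟩

theorem val_window (i : ℕ) (h : i + m ≤ k) (t : Fin m) : (window i h t : ℕ) = i + t :=
  rfl

theorem mem_range_window {i : ℕ} {h : i + m ≤ k} {l : Fin k} :
    l ∈ Set.range (window i h) ↔ i ≤ l ∧ (l : ℕ) < i + m := by
  constructor
  · rintro ⟨t, rfl⟩
    simp [val_window]
  · rintro ⟨h1, h2⟩
    exact ⟨⟨l - i, by omega⟩, Fin.ext (by simp [val_window]; omega)⟩

theorem disjoint_window {m' i j : ℕ} {h : i + m ≤ k} {h' : j + m' ≤ k}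
    (hij : i + m ≤ j) : Disjoint (Set.range (window i h)) (Set.range (window j h')) := by
  rw [Set.disjoint_left]
  intro l hl hl'
  rw [mem_range_window] at hl hl'
  omega

theorem localEmbed_matAt (X : Matrix (Fin N) (Fin N) α) {i j : ℕ} (h : i + m ≤ k)
    (hj : j < m) : localEmbed (window i h) (matAt N m X j) = matAt N k X (i + j) := by
  ext a b
  simp only [localEmbed, matAt, dif_pos hj, dif_pos (show i + j < k by omega), Matrix.of_apply]
  rw [← ite_and]
  congr 1
  refine propext ⟨fun ⟨h1, h2⟩ l hl => ?_, fun h1 => ⟨fun l hl => ?_, fun l hl => ?_⟩⟩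
  · by_cases hr : l ∈ Set.range (window i h)
    · obtain ⟨t, rfl⟩ := hr
      exact h2 t fun ht => hl (by simp [val_window, ht])
    · exact h1 l hr
  · exact h1 l fun hl' => hl (mem_range_window.2 (by omega))
  · exact h1 _ (by simp [val_window]; omega)

theorem localEmbed_opAt (X : Matrix (Fin N × Fin N) (Fin N × Fin N) α) {i j : ℕ}
    (h : i + m ≤ k) (hj : j + 1 < m) :
    localEmbed (window i h) (opAt N m X j) = opAt N k X (i + j) := by
  ext a b
  simp only [localEmbed, opAt, dif_pos hj, dif_pos (show i + j + 1 < k by omega),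
    Matrix.of_apply]
  rw [← ite_and]
  congr 1
  refine propext ⟨fun ⟨h1, h2⟩ l hl hl' => ?_, fun h1 => ⟨fun l hl => ?_, fun l hl hl' => ?_⟩⟩
  · by_cases hr : l ∈ Set.range (window i h)
    · obtain ⟨t, rfl⟩ := hr
      exact h2 t (fun ht => hl (by simp [val_window, ht])) fun ht => hl' (by simp [val_window, ht]; omega)
    · exact h1 l hr
  · exact h1 l (fun hl' => hl (mem_range_window.2 (by omega)))
      fun hl' => hl (mem_range_window.2 (by omega))
  · exact h1 _ (by simp [val_window]; omega) (by simp [val_window]; omega)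

theorem opAt_two (X : Matrix (Fin N × Fin N) (Fin N × Fin N) α) :
    opAt N 2 X 0 = X.submatrix (finTwoArrowEquiv (Fin N)) (finTwoArrowEquiv (Fin N)) := by
  ext a b
  simp only [opAt, dif_pos (show 0 + 1 < 2 by omega), Matrix.of_apply]
  rw [if_pos fun l hl hl' => by omega]
  rfl

theorem opAt_mul_opAt {X Y : Matrix (Fin N × Fin N) (Fin N × Fin N) α} (h : X * Y = 1)
    (i : ℕ) : opAt N k X i * opAt N k Y i = 1 := by
  by_cases hi : i + 1 < k
  · have hw : i + 2 ≤ k := by omega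
    have hX := localEmbed_opAt X (j := 0) hw (by omega)
    have hY := localEmbed_opAt Y (j := 0) hw (by omega)
    rw [add_zero] at hX hY
    rw [← hX, ← hY, ← localEmbed_mul, opAt_two, opAt_two, Matrix.submatrix_mul_equiv, h,
      Matrix.submatrix_one_equiv, localEmbed_one]
  · simp [opAt, hi]

end TensorFactors

section Numeric

variable {A : Type*} [Ring A] [Algebra ℂ A] {N k : ℕ}

theorem toA_mul {ι : Type*} [Fintype ι] (X Y : Matrix ι ι ℂ) :
    toA A (X * Y) = toA A X * toA A Y :=
  Matrix.map_mul

theorem toA_one {ι : Type*} [DecidableEq ι] : toA A (1 : Matrix ι ι ℂ) = 1 :=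
  Matrix.map_one _ (map_zero _) (map_one _)

theorem opAt_toA (X : Matrix (Fin N × Fin N) (Fin N × Fin N) ℂ) (i : ℕ) :
    opAt N k (toA A X) i = toA A (opAt N k X i) := by
  by_cases hi : i + 1 < k
  · ext a b
    simp only [opAt, dif_pos hi, toA, Matrix.of_apply, Matrix.map_apply]
    split_ifs <;> simp
  · simp only [opAt, dif_neg hi, toA_one]

theorem commute_toA_apply {ι : Type*} (X : Matrix ι ι ℂ) (i j : ι) (a : A) :
    Commute a (toA A X i j) :=
  (Algebra.commutes (X i j) a).symm

theorem commute_opAt_toA (X Y : Matrix (Fin N × Fin N) (Fin N × Fin N) ℂ) {i j : ℕ}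
    (hij : i + 2 ≤ j) : Commute (opAt N k (toA A X) i) (opAt N k (toA A Y) j) := by
  by_cases hj : j + 1 < k
  · have h1 := localEmbed_opAt (k := k) (toA A X) (i := i) (j := 0) (m := 2) (by omega) (by omega)
    have h2 := localEmbed_opAt (k := k) (toA A Y) (i := j) (j := 0) (m := 2) (by omega) (by omega)
    rw [add_zero] at h1 h2
    rw [← h1, ← h2]
    refine localEmbed_commute (disjoint_window hij) fun _ _ _ _ => ?_
    rw [opAt_toA Y]
    exact commute_toA_apply _ _ _ _
  · rw [opAt, opAt, dif_neg hj]
    exact Commute.one_right _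

theorem commute_matAt_opAt_toA (X : Matrix (Fin N) (Fin N) A)
    (Y : Matrix (Fin N × Fin N) (Fin N × Fin N) ℂ) {j : ℕ} (hj : 1 ≤ j) :
    Commute (matAt N k X 0) (opAt N k (toA A Y) j) := by
  by_cases hjk : j + 1 < k
  · have h1 := localEmbed_matAt (k := k) X (i := 0) (j := 0) (m := 1) (by omega) (by omega)
    have h2 := localEmbed_opAt (k := k) (toA A Y) (i := j) (j := 0) (m := 2) (by omega) (by omega)
    rw [add_zero] at h1 h2
    rw [← h1, ← h2]
    refine localEmbed_commute (disjoint_window (by omega)) fun _ _ _ _ => ?_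
    rw [opAt_toA Y]
    exact commute_toA_apply _ _ _ _
  · rw [opAt, dif_neg hjk]
    exact Commute.one_right _

theorem IsBraid.opAt_toA_eq {R : Matrix (Fin N × Fin N) (Fin N × Fin N) ℂ}
    (hR : IsBraid N R) {i : ℕ} (hi : i + 2 < k) :
    opAt N k (toA A R) i * opAt N k (toA A R) (i + 1) * opAt N k (toA A R) i =
      opAt N k (toA A R) (i + 1) * opAt N k (toA A R) i * opAt N k (toA A R) (i + 1) := by
  have hw : i + 3 ≤ k := by omega
  have h0 := localEmbed_opAt (toA A R) (j := 0) hw (by omega)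
  have h1 := localEmbed_opAt (toA A R) (j := 1) hw (by omega)
  rw [add_zero] at h0
  rw [← h0, ← h1]
  simp only [← localEmbed_mul, opAt_toA (k := 3), ← toA_mul]
  rw [hR]

theorem PermRel.mul_ovCopy_one {R Rinv : Matrix (Fin N × Fin N) (Fin N × Fin N) ℂ}
    {M D : Matrix (Fin N) (Fin N) A} (h : PermRel N R Rinv M D) (hR : R * Rinv = 1)
    (hk : 2 ≤ k) :
    matAt N k D 0 * ovCopy N k (toA A R) (toA A Rinv) M 1 =
      ovCopy N k (toA A R) (toA A Rinv) M 1 * matAt N k D 0 * opAt N k (toA A Rinv) 0 *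
        opAt N k (toA A Rinv) 0 + opAt N k (toA A Rinv) 0 := by
  have hRA : opAt N k (toA A R) 0 * opAt N k (toA A Rinv) 0 = 1 :=
    opAt_mul_opAt (by rw [← toA_mul, hR, toA_one]) 0
  have hw : 0 + 2 ≤ k := by omega
  have h' := congrArg (localEmbed (window 0 hw)) h
  simp only [localEmbed_mul, localEmbed_add, localEmbed_opAt _ hw (show 0 + 1 < 2 by omega),
    localEmbed_matAt _ hw (show 0 < 2 by omega), add_zero] at h'
  simp only [ovCopy]
  set r := opAt N k (toA A R) 0
  set r' := opAt N k (toA A Rinv) 0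
  set d := matAt N k D 0
  set x := matAt N k M 0
  calc d * (r * x * r') = d * r * x * (r * r') * r' := by rw [hRA]; noncomm_ring
    _ = (d * r * x * r) * r' * r' := by noncomm_ring
    _ = r * x * r' * d * r' * r' + (r * r') * r' := by rw [h']; noncomm_ring
    _ = r * x * r' * d * r' * r' + r' := by rw [hRA, one_mul]

end Numeric

/-- For every `k ≥ 1`, in `Mat_{N^{k+1}}(A)`:
`D₁ M_{⟨2⟩}⋯M_{⟨k+1⟩} = M_{⟨2⟩}⋯M_{⟨k+1⟩} D₁ R⁻¹_{1→k}R⁻¹_{k→1}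
  + Σ_{s=2}^{k+1} M_{⟨2⟩}⋯M̂_{⟨s⟩}⋯M_{⟨k+1⟩} · R₁⁻¹⋯R_{s−1}⁻¹R_{s−2}⁻¹⋯R₁⁻¹`. -/
theorem stmt4 {A : Type*} [Ring A] [Algebra ℂ A] (N : ℕ) (hN : 1 ≤ N) (q : ℂ)
    (hq : GenericQ q)
    (R Rinv : Matrix (Fin N × Fin N) (Fin N × Fin N) ℂ)
    (hRinv : R * Rinv = 1 ∧ Rinv * R = 1)
    (hbraid : IsBraid N R) (hHecke : IsHecke N q R)
    (M D : Matrix (Fin N) (Fin N) A)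
    (hM : RErel N (toA A R) M)
    (hD : RErel N (toA A Rinv) D)
    (hDM : PermRel N R Rinv M D)
    (k : ℕ) (hk : 1 ≤ k) :
    matAt N (k + 1) D 0 *
        ((List.range' 1 k).map (ovCopy N (k + 1) (toA A R) (toA A Rinv) M)).prod =
      ((List.range' 1 k).map (ovCopy N (k + 1) (toA A R) (toA A Rinv) M)).prod *
          matAt N (k + 1) D 0 *
          ((List.range k).map (opAt N (k + 1) (toA A Rinv))).prod *
          ((List.range k).reverse.map (opAt N (k + 1) (toA A Rinv))).prod +
        ∑ s ∈ Finset.Icc 2 (k + 1),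
          (((List.range' 1 k).filter (fun r => r != s - 1)).map
              (ovCopy N (k + 1) (toA A R) (toA A Rinv) M)).prod *
            ((List.range (s - 1)).map (opAt N (k + 1) (toA A Rinv))).prod *
            ((List.range (s - 2)).reverse.map (opAt N (k + 1) (toA A Rinv))).prod := by
  have hR : toA A R * toA A Rinv = 1 := by rw [← toA_mul, hRinv.1, toA_one]
  have hR' : toA A Rinv * toA A R = 1 := by rw [← toA_mul, hRinv.2, toA_one]
  let u : ℕ → (Matrix (Fin (k + 1) → Fin N) (Fin (k + 1) → Fin N) A)ˣ := fun i =>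
    ⟨opAt N (k + 1) (toA A R) i, opAt N (k + 1) (toA A Rinv) i, opAt_mul_opAt hR i,
      opAt_mul_opAt hR' i⟩
  exact mul_copies_eq (u := u) (m := ovCopy N (k + 1) (toA A R) (toA A Rinv) M)
    (d := matAt N (k + 1) D 0) (K := k) (fun _ => rfl) (fun _ _ h => commute_opAt_toA R R h)
    (fun _ h => commute_matAt_opAt_toA M R h) (fun _ h => commute_matAt_opAt_toA D R h)
    (fun i h => Units.ext (hbraid.opAt_toA_eq (i := i) (by omega)))
    (hDM.mul_ovCopy_one (k := k + 1) hRinv.1 (by omega)) le_rfl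
end
end
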